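/- Fix a real m > 0 and set p* = (m+1)^{−1/m}. Let p^0 be a probability mass function on ℤ with p^0_k ≤ p* for all k ∈ ℤ, and define p^n inductively by p^{n+1}_k = p^n_k(1 − (p^n_k)^m) + (1/2)(p^n_{k+1})^{m+1} + (1/2)(p^n_{k−1})^{m+1}. Then the functions x ↦ Σ_{k∈ℤ, k ≤ x·n^{1/(m+2)}} p^n_k converge, uniformly on compact subsets of ℝ, to the function x ↦ (1/B(a,a)) ∫_0^{min(max(1/2 + x/c_m, 0), 1)} y^{1/m}(1−y)^{1/m} dy with a = (m+1)/m, i.e. to the CDF of c_m(B − 1/2) where B is Beta(a,a)-distributed. -/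

import Mathlib

open Filter MeasureTheory

/-- The Beta function `B(a,b) = Γ(a)Γ(b)/Γ(a+b)`. -/
noncomputable def betaFn (a b : ℝ) : ℝ := Real.Gamma a * Real.Gamma b / Real.Gamma (a + b)

/-- `ρ = m/(2(m+2))`. -/
noncomputable def rhoC (m : ℝ) : ℝ := m / (2 * (m + 2))

/-- `D = ρ^{-1/2} B(1/2, (m+1)/m)`. -/
noncomputable def DC (m : ℝ) : ℝ := rhoC m ^ (-(1 / 2) : ℝ) * betaFn (1 / 2) ((m + 1) / m)

/-- `c_m = 2^{(m+1)/(m+2)} (m+1)^{1/(m+2)} / (D^{m/(m+2)} ρ^{1/2})`. -/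
noncomputable def cC (m : ℝ) : ℝ :=
  (2 : ℝ) ^ ((m + 1) / (m + 2)) * (m + 1) ^ (1 / (m + 2)) /
    (DC m ^ (m / (m + 2)) * rhoC m ^ ((1 : ℝ) / 2))

/-- The CDF of `c_m (B - 1/2)` where `B` is Beta((m+1)/m, (m+1)/m)-distributed. -/
noncomputable def limitCDF (m x : ℝ) : ℝ :=
  (1 / betaFn ((m + 1) / m) ((m + 1) / m)) *
    ∫ y in (0 : ℝ)..(min (max (1 / 2 + x / cC m) 0) 1), y ^ (1 / m) * (1 - y) ^ (1 / m)

/-- The recursion satisfied by the cumulative distribution functions of the `p n`. -/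
noncomputable def cdfStep (m : ℝ) (f : ℤ → ℝ) (k : ℤ) : ℝ :=
  f k + (1 / 2) * (f (k + 1) - f k) ^ (m + 1) - (1 / 2) * (f k - f (k - 1)) ^ (m + 1)

/-- The increments of `f` lie in `[0, (m+1)^(-1/m)]`. -/
def BoundedIncrements (m : ℝ) (f : ℤ → ℝ) : Prop :=
  ∀ k, 0 ≤ f k - f (k - 1) ∧ f k - f (k - 1) ≤ (m + 1) ^ (-(1 / m) : ℝ)

lemma threshold_rpow {m : ℝ} (hm : 0 < m) :
    (m + 1) * ((m + 1) ^ (-(1 / m) : ℝ)) ^ m = 1 := by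
  rw [← Real.rpow_mul (by linarith)]
  have : -(1 / m) * m = -1 := by field_simp
  rw [this, Real.rpow_neg_one]
  field_simp

lemma threshold_pos {m : ℝ} (hm : 0 < m) : 0 < (m + 1) ^ (-(1 / m) : ℝ) :=
  Real.rpow_pos_of_pos (by linarith) _

lemma threshold_le_one {m : ℝ} (hm : 0 < m) : (m + 1) ^ (-(1 / m) : ℝ) ≤ 1 :=
  Real.rpow_le_one_of_one_le_of_nonpos (by linarith) (neg_nonpos.2 (by positivity))

lemma rpow_sub_rpow_le_sub {m x y : ℝ} (hm : 0 < m) (hx : 0 ≤ x) (hxy : x ≤ y)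
    (hy : y ≤ (m + 1) ^ (-(1 / m) : ℝ)) : y ^ (m + 1) - x ^ (m + 1) ≤ y - x := by
  have hd : ∀ u : ℝ, HasDerivAt (fun u : ℝ => u ^ (m + 1)) ((m + 1) * u ^ m) u := fun u => by
    simpa using Real.hasDerivAt_rpow_const (x := u) (p := m + 1) (Or.inr (by linarith))
  have key := (convex_Icc (0 : ℝ) ((m + 1) ^ (-(1 / m) : ℝ))).image_sub_le_mul_sub_of_deriv_le
    (f := fun u : ℝ => u ^ (m + 1)) (C := 1)
    (fun u _ => (hd u).continuousAt.continuousWithinAt)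
    (fun u _ => (hd u).differentiableAt.differentiableWithinAt)
    (fun u hu => by
      have hu' := interior_subset hu
      rw [(hd u).deriv]
      refine le_of_le_of_eq ?_ (threshold_rpow hm)
      exact mul_le_mul_of_nonneg_left (Real.rpow_le_rpow hu'.1 hu'.2 hm.le) (by linarith))
    x ⟨hx, hxy.trans hy⟩ y ⟨hx.trans hxy, hy⟩ hxy
  simpa using key

lemma rpow_sub_rpow_le_of_sub_le {m x y c : ℝ} (hm : 0 < m) (hx : 0 ≤ x) (hy : 0 ≤ y)
    (hx' : x ≤ (m + 1) ^ (-(1 / m) : ℝ)) (hc : 0 ≤ c) (hxy : x - y ≤ c) :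
    x ^ (m + 1) - y ^ (m + 1) ≤ c := by
  rcases le_total x y with h | h
  · have := Real.rpow_le_rpow hx h (by linarith : 0 ≤ m + 1)
    linarith
  · exact (rpow_sub_rpow_le_sub hm hy h hx').trans hxy

/-- The scheme is monotone and commutes with adding constants. -/
lemma cdfStep_le {m c : ℝ} (hm : 0 < m) {f g : ℤ → ℝ} (hf : BoundedIncrements m f)
    (hg : BoundedIncrements m g) (h : ∀ k, f k ≤ g k + c) (k : ℤ) :
    cdfStep m f k ≤ cdfStep m g k + c := by
  have hf1 := hf (k + 1)
  have hg1 := hg (k + 1)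
  simp only [add_sub_cancel_right] at hf1 hg1
  have h1 := rpow_sub_rpow_le_of_sub_le hm hf1.1 hg1.1 hf1.2 (c := g k + c - f k)
    (by linarith [h k]) (by linarith [h (k + 1)])
  have h2 := rpow_sub_rpow_le_of_sub_le hm (hg k).1 (hf k).1 (hg k).2 (c := g k + c - f k)
    (by linarith [h k]) (by linarith [h (k - 1)])
  unfold cdfStep
  linarith

lemma le_add_of_approx_cdfStep {m c δ : ℝ} (hm : 0 < m) {U V : ℕ → ℤ → ℝ}
    (hU : ∀ n, BoundedIncrements m (U n)) (hV : ∀ n, BoundedIncrements m (V n))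
    (h0 : ∀ k, U 0 k ≤ V 0 k + c)
    (hstep : ∀ n k, U (n + 1) k - cdfStep m (U n) k ≤ V (n + 1) k - cdfStep m (V n) k + δ)
    (n : ℕ) : ∀ k, U n k ≤ V n k + (c + n * δ) := by
  induction n with
  | zero => simpa using h0
  | succ n ih =>
    intro k
    have := cdfStep_le hm (hU n) (hV n) ih k
    have := hstep n k
    push_cast
    linarith

section Mass

variable {m : ℝ} {p : ℕ → ℤ → ℝ}

lemma mem_Icc_threshold (hm : 0 < m) (h0nonneg : ∀ k : ℤ, 0 ≤ p 0 k)
    (h0bdd : ∀ k : ℤ, p 0 k ≤ (m + 1) ^ (-(1 / m) : ℝ))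
    (hrec : ∀ (n : ℕ) (k : ℤ), p (n + 1) k = p n k * (1 - p n k ^ m)
      + (1 / 2) * p n (k + 1) ^ (m + 1) + (1 / 2) * p n (k - 1) ^ (m + 1)) (n : ℕ) :
    ∀ k, 0 ≤ p n k ∧ p n k ≤ (m + 1) ^ (-(1 / m) : ℝ) := by
  induction n with
  | zero => exact fun k => ⟨h0nonneg k, h0bdd k⟩
  | succ n ih =>
    intro k
    have e : p n k * (1 - p n k ^ m) = p n k - p n k ^ (m + 1) := by
      rw [Real.rpow_add_one' (ih k).1 (by linarith)]; ring
    have h1 := Real.rpow_nonneg (ih (k + 1)).1 (m + 1)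
    have h2 := Real.rpow_nonneg (ih (k - 1)).1 (m + 1)
    have h3 := rpow_sub_rpow_le_sub hm le_rfl (ih k).1 (ih k).2
    rw [Real.zero_rpow (by linarith)] at h3
    have h4 := rpow_sub_rpow_le_sub hm (ih k).1 (ih k).2 le_rfl
    have h5 := Real.rpow_le_rpow (ih (k + 1)).1 (ih (k + 1)).2 (by linarith : 0 ≤ m + 1)
    have h6 := Real.rpow_le_rpow (ih (k - 1)).1 (ih (k - 1)).2 (by linarith : 0 ≤ m + 1)
    rw [hrec, e]
    constructor <;> linarith

lemma rpow_succ_le_self (hm : 0 < m) {x : ℝ} (hx : 0 ≤ x) (hx' : x ≤ (m + 1) ^ (-(1 / m) : ℝ)) :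
    x ^ (m + 1) ≤ x :=
  Real.rpow_le_self_of_le_one hx (hx'.trans (threshold_le_one hm)) (by linarith)

lemma summable_rpow_succ (hm : 0 < m) {q : ℤ → ℝ}
    (hq : ∀ k, 0 ≤ q k ∧ q k ≤ (m + 1) ^ (-(1 / m) : ℝ)) (hs : Summable q) :
    Summable fun k => q k ^ (m + 1) :=
  hs.of_nonneg_of_le (fun k => Real.rpow_nonneg (hq k).1 _)
    fun k => rpow_succ_le_self hm (hq k).1 (hq k).2

/-- The cumulative sums of a summable family on `ℤ`. -/
noncomputable def cumSum (q : ℤ → ℝ) (k : ℤ) : ℝ := ∑' j, if j ≤ k then q j else 0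

lemma Summable.ite_le {q : ℤ → ℝ} (hs : Summable q) (k : ℤ) :
    Summable fun j => if j ≤ k then q j else 0 := by
  exact (hs.indicator (Set.Iic k)).congr fun j => by simp [Set.indicator_apply]

lemma cumSum_sub_pred {q : ℤ → ℝ} (hs : Summable q) (k : ℤ) :
    cumSum q k - cumSum q (k - 1) = q k := by
  unfold cumSum
  rw [← (hs.ite_le k).tsum_sub (hs.ite_le (k - 1)), tsum_eq_single k]
  · simp
  · intro j hj
    rcases lt_or_gt_of_ne hj with h | h
    · simp [h.le, Int.le_sub_one_of_lt h]
    · simp [h.not_ge, show ¬ j ≤ k - 1 by omega]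

lemma cumSum_shift (q : ℤ → ℝ) (k c : ℤ) : cumSum (fun j => q (j + c)) k = cumSum q (k + c) := by
  unfold cumSum
  rw [← (Equiv.addRight c).tsum_eq fun j => if j ≤ k + c then q j else 0]
  simp

lemma cumSum_add {q r : ℤ → ℝ} (hq : Summable q) (hr : Summable r) (k : ℤ) :
    cumSum (fun j => q j + r j) k = cumSum q k + cumSum r k := by
  unfold cumSum
  rw [← (hq.ite_le k).tsum_add (hr.ite_le k)]
  exact tsum_congr fun j => by split_ifs <;> simp

lemma cumSum_mul_left (c : ℝ) (q : ℤ → ℝ) (k : ℤ) :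
    cumSum (fun j => c * q j) k = c * cumSum q k := by
  unfold cumSum
  rw [← tsum_mul_left]
  exact tsum_congr fun j => by split_ifs <;> simp

lemma cumSum_sub {q r : ℤ → ℝ} (hq : Summable q) (hr : Summable r) (k : ℤ) :
    cumSum (fun j => q j - r j) k = cumSum q k - cumSum r k := by
  unfold cumSum
  rw [← (hq.ite_le k).tsum_sub (hr.ite_le k)]
  exact tsum_congr fun j => by split_ifs <;> simp

lemma summable_mass (hm : 0 < m) (h0sum : Summable (p 0))
    (hp : ∀ n k, 0 ≤ p n k ∧ p n k ≤ (m + 1) ^ (-(1 / m) : ℝ))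
    (hrec : ∀ (n : ℕ) (k : ℤ), p (n + 1) k = p n k * (1 - p n k ^ m)
      + (1 / 2) * p n (k + 1) ^ (m + 1) + (1 / 2) * p n (k - 1) ^ (m + 1)) (n : ℕ) :
    Summable (p n) := by
  induction n with
  | zero => exact h0sum
  | succ n ih =>
    have hs := summable_rpow_succ hm (hp n) ih
    have e : p (n + 1) = fun k => p n k - p n k ^ (m + 1) + (1 / 2) * p n (k + 1) ^ (m + 1)
        + (1 / 2) * p n (k - 1) ^ (m + 1) := by
      ext k
      rw [hrec, Real.rpow_add_one' (hp n k).1 (by linarith)]; ring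
    rw [e]
    exact ((ih.sub hs).add (((Equiv.addRight (1 : ℤ)).summable_iff.2 hs).mul_left _)).add
      (((Equiv.addRight (-1 : ℤ)).summable_iff.2 hs).mul_left _)

lemma cumSum_succ (hm : 0 < m) (hsum : ∀ n, Summable (p n))
    (hp : ∀ n k, 0 ≤ p n k ∧ p n k ≤ (m + 1) ^ (-(1 / m) : ℝ))
    (hrec : ∀ (n : ℕ) (k : ℤ), p (n + 1) k = p n k * (1 - p n k ^ m)
      + (1 / 2) * p n (k + 1) ^ (m + 1) + (1 / 2) * p n (k - 1) ^ (m + 1)) (n : ℕ) (k : ℤ) :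
    cumSum (p (n + 1)) k = cdfStep m (cumSum (p n)) k := by
  obtain ⟨q, hq⟩ : ∃ q : ℤ → ℝ, q = fun k => p n k ^ (m + 1) := ⟨_, rfl⟩
  have hq' : ∀ k, p n k ^ (m + 1) = q k := fun k => by rw [hq]
  have hs : Summable q := hq ▸ summable_rpow_succ hm (hp n) (hsum n)
  have hs1 : Summable fun j => (1 / 2) * q (j + 1) :=
    (hs.comp_injective (add_left_injective (1 : ℤ))).mul_left _
  have hs2 : Summable fun j => (1 / 2) * q (j + -1) :=
    (hs.comp_injective (add_left_injective (-1 : ℤ))).mul_left _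
  have e : cumSum (p (n + 1)) k = cumSum (p n) k - cumSum q k
      + (1 / 2) * cumSum (fun j => q (j + 1)) k + (1 / 2) * cumSum (fun j => q (j + -1)) k := by
    have e1 : p (n + 1) = fun j => p n j - q j + (1 / 2) * q (j + 1) + (1 / 2) * q (j + -1) := by
      ext j
      have h1 : p n j * (1 - p n j ^ m) = p n j - q j := by
        rw [← hq', Real.rpow_add_one' (hp n j).1 (by linarith)]
        ring
      rw [hrec, h1, hq', hq', ← sub_eq_add_neg j 1]
    rw [e1, cumSum_add (((hsum n).sub hs).add hs1) hs2, cumSum_add ((hsum n).sub hs) hs1,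
      cumSum_sub (hsum n) hs, cumSum_mul_left, cumSum_mul_left]
  have a1 := cumSum_sub_pred hs (k + 1)
  have a2 := cumSum_sub_pred hs k
  have b1 := cumSum_sub_pred (hsum n) (k + 1)
  have b2 := cumSum_sub_pred (hsum n) k
  rw [add_sub_cancel_right] at a1 b1
  rw [cumSum_shift, cumSum_shift, ← sub_eq_add_neg] at e
  rw [cdfStep, b1, b2, e, hq', hq']
  linarith

lemma exists_cumSum_tails {q : ℤ → ℝ} (hq : ∀ k, 0 ≤ q k) (hs : HasSum q 1) {ε : ℝ}
    (hε : 0 < ε) : ∃ R : ℝ, 0 ≤ R ∧ (∀ k : ℤ, (k : ℝ) < -R → cumSum q k ≤ ε) ∧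
      ∀ k : ℤ, R ≤ k → 1 - ε ≤ cumSum q k := by
  obtain ⟨s, hs1⟩ := (hs.eventually (lt_mem_nhds (show 1 - ε < 1 by linarith))).exists
  refine ⟨∑ j ∈ s, |(j : ℝ)|, Finset.sum_nonneg fun _ _ => abs_nonneg _, fun k hk => ?_,
    fun k hk => ?_⟩
  · have hdis : ∀ j ∈ s, ¬ j ≤ k := fun j hj hjk => by
      have h1 := Finset.single_le_sum (f := fun j : ℤ => |(j : ℝ)|)
        (fun _ _ => abs_nonneg _) hj
      have h2 : (j : ℝ) ≤ k := by exact_mod_cast hjk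
      have := neg_abs_le (j : ℝ)
      linarith
    have h3 := (hs.summable.sub (hs.summable.ite_le k)).sum_le_tsum s fun j _ => by
      split_ifs <;> simp [hq]
    rw [hs.summable.tsum_sub (hs.summable.ite_le k), hs.tsum_eq,
      Finset.sum_congr rfl fun j hj => by rw [if_neg (hdis j hj), sub_zero]] at h3
    change _ ≤ 1 - cumSum q k at h3
    linarith
  · have hin : ∀ j ∈ s, j ≤ k := fun j hj => by
      have h1 := Finset.single_le_sum (f := fun j : ℤ => |(j : ℝ)|)
        (fun _ _ => abs_nonneg _) hj
      have := le_abs_self (j : ℝ)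
      exact_mod_cast (show (j : ℝ) ≤ k by linarith)
    have h3 := (hs.summable.ite_le k).sum_le_tsum s fun j _ => by
      split_ifs <;> simp [hq]
    rw [Finset.sum_congr rfl fun j hj => by rw [if_pos (hin j hj)]] at h3
    change _ ≤ cumSum q k at h3
    linarith

lemma cumSum_mem_Icc {q : ℤ → ℝ} (hq : ∀ k, 0 ≤ q k) (hs : HasSum q 1) (k : ℤ) :
    0 ≤ cumSum q k ∧ cumSum q k ≤ 1 := by
  constructor
  · exact tsum_nonneg fun j => by split_ifs <;> simp [hq]
  · rw [← hs.tsum_eq]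
    exact (hs.summable.ite_le k).tsum_le_tsum (fun j => by split_ifs <;> simp [hq]) hs.summable

end Mass

/-- The self-similar Barenblatt profile with support `[-L, L]`. -/
noncomputable def barenblatt (m κ L x : ℝ) : ℝ := (max (κ * (L ^ 2 - x ^ 2)) 0) ^ (1 / m)

/-- `Φ` is the cumulative distribution function of a unit-mass Barenblatt profile solving
`uₜ = (uᵐ⁺¹)ₓₓ / 2`. -/
structure IsBarenblattCDF (m κ L : ℝ) (Φ : ℝ → ℝ) : Prop where
  m_pos : 0 < m
  L_pos : 0 < L
  κ_pos : 0 < κ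
  coeff : κ * ((m + 1) * (m + 2)) = m
  hasDerivAt : ∀ x, HasDerivAt Φ (barenblatt m κ L x) x
  eq_zero : ∀ x ≤ -L, Φ x = 0
  eq_one : ∀ x, L ≤ x → Φ x = 1

section Profile

variable {m : ℝ}

lemma betaFn_pos {a b : ℝ} (ha : 0 < a) (hb : 0 < b) : 0 < betaFn a b :=
  div_pos (mul_pos (Real.Gamma_pos_of_pos ha) (Real.Gamma_pos_of_pos hb))
    (Real.Gamma_pos_of_pos (by linarith))

lemma betaFn_self {a : ℝ} (ha : 0 < a) : betaFn a a = 2 ^ (1 - 2 * a) * betaFn (1 / 2) a := by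
  have h := Real.Gamma_mul_Gamma_add_half a
  have h1 := Real.Gamma_pos_of_pos (show 0 < a + 1 / 2 by linarith)
  have h2 := Real.Gamma_pos_of_pos (show 0 < 2 * a by linarith)
  unfold betaFn
  rw [← two_mul, Real.Gamma_one_half_eq, add_comm (1 / 2) a]
  rw [div_eq_iff h2.ne', mul_div_assoc', div_mul_eq_mul_div, eq_div_iff h1.ne']
  linear_combination Real.Gamma a * h

lemma rhoC_pos (hm : 0 < m) : 0 < rhoC m := by unfold rhoC; positivity

lemma DC_pos (hm : 0 < m) : 0 < DC m :=
  mul_pos (Real.rpow_pos_of_pos (rhoC_pos hm) _) (betaFn_pos (by norm_num) (by positivity))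

lemma cC_pos (hm : 0 < m) : 0 < cC m := by
  have h1 := DC_pos hm
  have h2 := rhoC_pos hm
  unfold cC
  positivity

lemma cC_rpow (hm : 0 < m) :
    cC m ^ (m + 2) = 2 ^ (m + 1) * (m + 1) / (rhoC m * betaFn (1 / 2) ((m + 1) / m) ^ m) := by
  have h1 := DC_pos hm
  have h2 := rhoC_pos hm
  have h3 : 0 < betaFn (1 / 2) ((m + 1) / m) := betaFn_pos (by norm_num) (by positivity)
  have hm2 : m + 2 ≠ 0 := by positivity
  unfold cC
  rw [Real.div_rpow (by positivity) (by positivity), Real.mul_rpow (by positivity) (by positivity),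
    Real.mul_rpow (by positivity) (by positivity), ← Real.rpow_mul (by norm_num),
    ← Real.rpow_mul (by positivity), ← Real.rpow_mul (by positivity),
    ← Real.rpow_mul (by positivity), div_mul_cancel₀ _ hm2, div_mul_cancel₀ _ hm2,
    div_mul_cancel₀ _ hm2, Real.rpow_one]
  congr 1
  unfold DC
  rw [Real.mul_rpow (by positivity) (by positivity), ← Real.rpow_mul (by positivity),
    mul_right_comm, ← Real.rpow_add h2]
  congr 1
  rw [show -(1 / 2) * m + 1 / 2 * (m + 2) = 1 by ring, Real.rpow_one]

lemma normalization (hm : 0 < m) :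
    m / ((m + 1) * (m + 2)) * cC m ^ (m + 2) * betaFn ((m + 1) / m) ((m + 1) / m) ^ m = 1 := by
  have h2 := rhoC_pos hm
  have h3 : 0 < betaFn (1 / 2) ((m + 1) / m) := betaFn_pos (by norm_num) (by positivity)
  rw [cC_rpow hm, betaFn_self (by positivity), Real.mul_rpow (by positivity) (by positivity),
    ← Real.rpow_mul (by norm_num), show (1 - 2 * ((m + 1) / m)) * m = -(m + 1) + -1 by
      field_simp; ring, Real.rpow_add (by norm_num) (-(m + 1)), Real.rpow_neg (by norm_num)]
  unfold rhoC
  have h4 : (2 : ℝ) ^ (m + 1) ≠ 0 := by positivity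
  have h5 : betaFn (1 / 2) ((m + 1) / m) ^ m ≠ 0 := by positivity
  rw [Real.rpow_neg_one]
  field_simp

lemma profile_scale (hm : 0 < m) :
    (m / ((m + 1) * (m + 2)) * cC m ^ 2) ^ (1 / m)
      = (betaFn ((m + 1) / m) ((m + 1) / m))⁻¹ * (cC m)⁻¹ := by
  have hc := cC_pos hm
  have hB : 0 < betaFn ((m + 1) / m) ((m + 1) / m) := betaFn_pos (by positivity) (by positivity)
  have h := normalization hm
  rw [Real.rpow_add hc, Real.rpow_two] at h
  have e : m / ((m + 1) * (m + 2)) * cC m ^ 2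
      = ((betaFn ((m + 1) / m) ((m + 1) / m))⁻¹ * (cC m)⁻¹) ^ m := by
    rw [← mul_inv, Real.inv_rpow (by positivity), Real.mul_rpow hB.le hc.le]
    refine eq_inv_of_mul_eq_one_left ?_
    linear_combination h
  rw [e, ← Real.rpow_mul (by positivity), mul_one_div_cancel hm.ne', Real.rpow_one]

/-- The unnormalized Beta density, extended by zero. -/
noncomputable def betaBump (m y : ℝ) : ℝ := (max (y * (1 - y)) 0) ^ (1 / m)

lemma continuous_betaBump (hm : 0 < m) : Continuous (betaBump m) := by
  have : 0 ≤ 1 / m := by positivity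
  unfold betaBump
  exact (by fun_prop : Continuous fun y : ℝ => max (y * (1 - y)) 0).rpow_const
    fun _ => Or.inr this

lemma betaBump_eq_zero (hm : 0 < m) {y : ℝ} (hy : y ≤ 0 ∨ 1 ≤ y) : betaBump m y = 0 := by
  have : y * (1 - y) ≤ 0 := by rcases hy with h | h <;> nlinarith
  rw [betaBump, max_eq_right this, Real.zero_rpow (by positivity)]

lemma betaBump_of_mem {y : ℝ} (hy : y ∈ Set.Icc (0 : ℝ) 1) :
    betaBump m y = y ^ (1 / m) * (1 - y) ^ (1 / m) := by
  have h1 : 0 ≤ 1 - y := by linarith [hy.2]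
  rw [betaBump, max_eq_left (mul_nonneg hy.1 h1), Real.mul_rpow hy.1 h1]

lemma integral_betaBump_clamp (hm : 0 < m) (z : ℝ) :
    ∫ y in (0 : ℝ)..(min (max z 0) 1), y ^ (1 / m) * (1 - y) ^ (1 / m)
      = ∫ y in (0 : ℝ)..z, betaBump m y := by
  have hc := continuous_betaBump hm
  have key : ∀ w ∈ Set.Icc (0 : ℝ) 1, ∫ y in (0 : ℝ)..w, y ^ (1 / m) * (1 - y) ^ (1 / m)
      = ∫ y in (0 : ℝ)..w, betaBump m y := fun w hw =>
    intervalIntegral.integral_congr fun y hy => by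
      rw [Set.uIcc_of_le hw.1] at hy
      exact (betaBump_of_mem ⟨hy.1, hy.2.trans hw.2⟩).symm
  rcases le_total z 0 with h | h
  · rw [max_eq_right h, min_eq_left zero_le_one, intervalIntegral.integral_same,
      intervalIntegral.integral_congr (g := fun _ => 0), intervalIntegral.integral_zero]
    intro y hy
    rw [Set.uIcc_of_ge h] at hy
    exact betaBump_eq_zero hm (Or.inl hy.2)
  · rw [max_eq_left h]
    rcases le_total z 1 with h' | h'
    · rw [min_eq_left h', key z ⟨h, h'⟩]
    · rw [min_eq_right h', key 1 ⟨zero_le_one, le_rfl⟩,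
        ← intervalIntegral.integral_add_adjacent_intervals (hc.intervalIntegrable 0 1)
          (hc.intervalIntegrable 1 z),
        intervalIntegral.integral_congr (a := 1) (g := fun _ => 0), intervalIntegral.integral_zero,
        add_zero]
      intro y hy
      rw [Set.uIcc_of_le h'] at hy
      exact betaBump_eq_zero hm (Or.inr hy.1)

lemma integral_beta (hm : 0 < m) : ∫ y in (0 : ℝ)..1, y ^ (1 / m) * (1 - y) ^ (1 / m)
    = betaFn ((m + 1) / m) ((m + 1) / m) := by
  have ha : 0 < (m + 1) / m := by positivity
  have h := ProbabilityTheory.beta_eq_betaIntegralReal _ _ ha ha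
  change betaFn _ _ = _ at h
  rw [h, Complex.betaIntegral]
  have e : ∀ y ∈ Set.uIcc (0 : ℝ) 1,
      (y : ℂ) ^ ((((m + 1) / m : ℝ) : ℂ) - 1) * (1 - (y : ℂ)) ^ ((((m + 1) / m : ℝ) : ℂ) - 1)
        = ((y ^ (1 / m) * (1 - y) ^ (1 / m) : ℝ) : ℂ) := fun y hy => by
    rw [Set.uIcc_of_le zero_le_one] at hy
    rw [show (((m + 1) / m : ℝ) : ℂ) - 1 = ((1 / m : ℝ) : ℂ) by
      rw [← Complex.ofReal_one, ← Complex.ofReal_sub]; congr 1; field_simp; ring]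
    rw [Complex.ofReal_mul, Complex.ofReal_cpow hy.1, Complex.ofReal_cpow (by linarith [hy.2])]
    push_cast
    rfl
  rw [intervalIntegral.integral_congr e, intervalIntegral.integral_ofReal, Complex.ofReal_re]

lemma isBarenblattCDF_limitCDF (hm : 0 < m) :
    IsBarenblattCDF m (m / ((m + 1) * (m + 2))) (cC m / 2) (limitCDF m) where
  m_pos := hm
  L_pos := half_pos (cC_pos hm)
  κ_pos := by positivity
  coeff := by field_simp
  hasDerivAt x := by
    have hc := cC_pos hm
    have hb := continuous_betaBump hm
    have e : limitCDF m = fun x => (1 / betaFn ((m + 1) / m) ((m + 1) / m)) *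
        ∫ y in (0 : ℝ)..(1 / 2 + x / cC m), betaBump m y := by
      ext x
      rw [limitCDF, integral_betaBump_clamp hm]
    have h1 : HasDerivAt (fun x => 1 / 2 + x / cC m) (1 / cC m) x :=
      ((hasDerivAt_id x).div_const _).const_add _
    have h2 := (intervalIntegral.integral_hasDerivAt_right
      (hb.intervalIntegrable 0 (1 / 2 + x / cC m))
      (hb.stronglyMeasurableAtFilter _ _) hb.continuousAt).comp x h1
    rw [e]
    refine (h2.const_mul (1 / betaFn ((m + 1) / m) ((m + 1) / m))).congr_deriv (Eq.symm ?_)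
    unfold barenblatt betaBump
    rw [show (1 / 2 + x / cC m) * (1 - (1 / 2 + x / cC m))
      = 1 / 4 - x ^ 2 / cC m ^ 2 by ring, show m / ((m + 1) * (m + 2)) * ((cC m / 2) ^ 2 - x ^ 2)
      = (m / ((m + 1) * (m + 2)) * cC m ^ 2) * (1 / 4 - x ^ 2 / cC m ^ 2) by field_simp; ring]
    have hs : 0 ≤ m / ((m + 1) * (m + 2)) * cC m ^ 2 := by positivity
    have hmax : ∀ w : ℝ, max (m / ((m + 1) * (m + 2)) * cC m ^ 2 * w) 0
        = m / ((m + 1) * (m + 2)) * cC m ^ 2 * max w 0 := fun w => by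
      rw [mul_max_of_nonneg _ _ hs, mul_zero]
    rw [hmax, Real.mul_rpow hs (le_max_right _ _), profile_scale hm]
    ring
  eq_zero x hx := by
    have hc := cC_pos hm
    have : 1 / 2 + x / cC m ≤ 0 := by
      have : x / cC m ≤ -(1 / 2) := by rw [div_le_iff₀ hc]; linarith
      linarith
    rw [limitCDF, max_eq_right this, min_eq_left zero_le_one, intervalIntegral.integral_same,
      mul_zero]
  eq_one x hx := by
    have hc := cC_pos hm
    have : 1 ≤ 1 / 2 + x / cC m := by
      have : 1 / 2 ≤ x / cC m := by rw [le_div_iff₀ hc]; linarith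
      linarith
    rw [limitCDF, min_eq_right (this.trans (le_max_left _ _)), integral_beta hm,
      one_div_mul_cancel (betaFn_pos (by positivity) (by positivity)).ne']

end Profile

open Topology in
lemma HasStrictDerivAt.tendsto_slope_prod {f : ℝ → ℝ} {f' a₀ : ℝ} (hf : HasStrictDerivAt f f' a₀) :
    Tendsto (fun z : ℝ × ℝ => (f (z.2 + z.1) - f z.2) / z.1) (𝓝[>] 0 ×ˢ 𝓝 a₀) (𝓝 f') := by
  have hs : Tendsto (fun z : ℝ × ℝ => (z.2 + z.1, z.2)) (𝓝[>] 0 ×ˢ 𝓝 a₀) (𝓝 (a₀, a₀)) := by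
    have h1 : Tendsto (fun z : ℝ × ℝ => z.1) (𝓝[>] 0 ×ˢ 𝓝 a₀) (𝓝 0) :=
      tendsto_fst.mono_right nhdsWithin_le_nhds
    have h2 : Tendsto (fun z : ℝ × ℝ => z.2) (𝓝[>] 0 ×ˢ 𝓝 a₀) (𝓝 a₀) := tendsto_snd
    rw [nhds_prod_eq]
    exact (by simpa using h2.add h1 : Tendsto _ _ (𝓝 a₀)).prodMk h2
  have h := (hasStrictDerivAt_iff_hasStrictFDerivAt.1 hf).isLittleO.comp_tendsto hs
  have h' := h.tendsto_div_nhds_zero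
  have hpos : ∀ᶠ z : ℝ × ℝ in 𝓝[>] 0 ×ˢ 𝓝 a₀, 0 < z.1 :=
    tendsto_fst.eventually eventually_mem_nhdsWithin
  rw [← zero_add f']
  refine (h'.add_const f').congr' ?_
  filter_upwards [hpos] with z hz
  simp
  field_simp
  ring

lemma mul_rpow_sub_rpow_le {q μ M : ℝ} (hq : 0 < q) (hμ : 0 ≤ μ) (hM : μ ≤ M) :
    M * (M ^ q - μ ^ q) ≤ (1 + q) * M ^ q * (M - μ) := by
  rcases (hμ.trans hM).eq_or_lt with h0 | h0
  · have : μ = 0 := by linarith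
    simp [← h0, this]
  · obtain ⟨r, rfl⟩ : ∃ r, μ = M * r := ⟨μ / M, by field_simp⟩
    have hr : 0 ≤ r := nonneg_of_mul_nonneg_right hμ h0
    have hr1 : r ≤ 1 := by
      by_contra! h
      nlinarith
    have key : 1 - r ^ q ≤ (1 + q) * (1 - r) := by
      rcases le_total q 1 with h | h
      · have := Real.self_le_rpow_of_le_one hr hr1 h
        nlinarith
      · have := one_add_mul_self_le_rpow_one_add (s := r - 1) (by linarith) h
        rw [add_sub_cancel] at this
        nlinarith
    rw [Real.mul_rpow h0.le hr]
    have := mul_le_mul_of_nonneg_left key (by positivity : 0 ≤ M * M ^ q)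
    nlinarith

namespace IsBarenblattCDF

open Topology

variable {m κ L : ℝ} {Φ : ℝ → ℝ}

lemma continuous_barenblatt (H : IsBarenblattCDF m κ L Φ) : Continuous (barenblatt m κ L) := by
  have : 0 ≤ 1 / m := by have := H.m_pos; positivity
  unfold barenblatt
  exact (by fun_prop : Continuous fun x : ℝ => max (κ * (L ^ 2 - x ^ 2)) 0).rpow_const
    fun _ => Or.inr this

lemma barenblatt_nonneg (x : ℝ) : 0 ≤ barenblatt m κ L x :=
  Real.rpow_nonneg (le_max_right _ _) _

lemma barenblatt_rpow (H : IsBarenblattCDF m κ L Φ) (x : ℝ) :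
    barenblatt m κ L x ^ m = max (κ * (L ^ 2 - x ^ 2)) 0 := by
  rw [barenblatt, ← Real.rpow_mul (le_max_right _ _), one_div_mul_cancel H.m_pos.ne', Real.rpow_one]

lemma barenblatt_le (H : IsBarenblattCDF m κ L Φ) (x : ℝ) :
    barenblatt m κ L x ≤ barenblatt m κ L 0 := by
  have h1 := H.m_pos
  have h2 := H.κ_pos
  refine Real.rpow_le_rpow (le_max_right _ _) (max_le_max_right _ ?_) (by positivity)
  exact mul_le_mul_of_nonneg_left (by nlinarith [sq_nonneg x]) h2.le

lemma continuous (H : IsBarenblattCDF m κ L Φ) : Continuous Φ :=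
  continuous_iff_continuousAt.2 fun x => (H.hasDerivAt x).continuousAt

lemma monotone (H : IsBarenblattCDF m κ L Φ) : Monotone Φ :=
  monotone_of_deriv_nonneg (fun x => (H.hasDerivAt x).differentiableAt) fun x => by
    rw [(H.hasDerivAt x).deriv]
    exact barenblatt_nonneg x

lemma nonneg (H : IsBarenblattCDF m κ L Φ) (x : ℝ) : 0 ≤ Φ x := by
  rw [← H.eq_zero _ (min_le_left (-L) x)]
  exact H.monotone (min_le_right _ _)

lemma le_one (H : IsBarenblattCDF m κ L Φ) (x : ℝ) : Φ x ≤ 1 := by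
  rw [← H.eq_one _ (le_max_left L x)]
  exact H.monotone (le_max_right _ _)

lemma abs_sub_le (H : IsBarenblattCDF m κ L Φ) (x y : ℝ) :
    |Φ x - Φ y| ≤ barenblatt m κ L 0 * |x - y| := by
  have := convex_univ.norm_image_sub_le_of_norm_hasDerivWithin_le (f := Φ)
    (fun x _ => (H.hasDerivAt x).hasDerivWithinAt) (C := barenblatt m κ L 0)
    (fun x _ => by rw [Real.norm_of_nonneg (barenblatt_nonneg x)]; exact H.barenblatt_le x)
    (Set.mem_univ y) (Set.mem_univ x)
  simpa using this

lemma hasStrictDerivAt (H : IsBarenblattCDF m κ L Φ) (x : ℝ) :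
    HasStrictDerivAt Φ (barenblatt m κ L x) x :=
  hasStrictDerivAt_of_hasDerivAt_of_continuousAt (.of_forall H.hasDerivAt)
    H.continuous_barenblatt.continuousAt

/-- The derivative in `a` of `((Φ (a + h) - Φ a) / h) ^ (m + 1)`, at `z = (h, a)`. -/
noncomputable def fluxSlope (m κ L : ℝ) (Φ : ℝ → ℝ) (z : ℝ × ℝ) : ℝ :=
  (m + 1) * ((Φ (z.2 + z.1) - Φ z.2) / z.1) ^ m *
    ((barenblatt m κ L (z.2 + z.1) - barenblatt m κ L z.2) / z.1)

lemma tendsto_fluxSlope_of_lt (H : IsBarenblattCDF m κ L Φ) {a₀ : ℝ} (ha : a₀ ^ 2 < L ^ 2) :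
    Tendsto (fluxSlope m κ L Φ) (𝓝[>] 0 ×ˢ 𝓝 a₀)
      (𝓝 (-2 / (m + 2) * a₀ * barenblatt m κ L a₀)) := by
  have hm := H.m_pos
  have hκ := H.κ_pos
  have hw : 0 < κ * (L ^ 2 - a₀ ^ 2) := mul_pos hκ (by linarith)
  have h1 := (H.hasStrictDerivAt a₀).tendsto_slope_prod
  have hi : HasStrictDerivAt (fun x : ℝ => κ * (L ^ 2 - x ^ 2)) (κ * (-(2 * a₀))) a₀ := by
    have := (((hasStrictDerivAt_pow 2 a₀).const_sub (L ^ 2)).const_mul κ)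
    simpa using this
  have hF : HasStrictDerivAt (barenblatt m κ L)
      ((1 / m) * (κ * (L ^ 2 - a₀ ^ 2)) ^ (1 / m - 1) * (κ * (-(2 * a₀)))) a₀ := by
    refine ((Real.hasStrictDerivAt_rpow_const_of_ne hw.ne' (1 / m)).comp a₀ hi).congr_of_eventuallyEq
      ?_
    have hc : Continuous fun x : ℝ => κ * (L ^ 2 - x ^ 2) := by fun_prop
    filter_upwards [hc.continuousAt.eventually (lt_mem_nhds hw)] with x hx
    simp only [barenblatt, Function.comp]
    rw [max_eq_left hx.le]
  have h2 := hF.tendsto_slope_prod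
  have h3 := ((h1.rpow_const (p := m) (Or.inr hm.le)).const_mul (m + 1)).mul h2
  convert h3 using 2
  · rfl
  rw [H.barenblatt_rpow, barenblatt, max_eq_left hw.le, Real.rpow_sub_one hw.ne']
  have hk : κ = m / ((m + 1) * (m + 2)) := by
    rw [eq_div_iff (by positivity)]
    exact H.coeff
  have hne : κ * (L ^ 2 - a₀ ^ 2) ≠ 0 := hw.ne'
  have e : (m + 1) * κ * (1 / m) = 1 / (m + 2) := by rw [hk]; field_simp
  generalize (κ * (L ^ 2 - a₀ ^ 2)) ^ (1 / m) = G
  generalize κ * (L ^ 2 - a₀ ^ 2) = w at hne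
  have hG : w * (G / w) = G := mul_div_cancel₀ _ hne
  linear_combination (2 * a₀ * (m + 1) * κ * (1 / m)) * hG + 2 * a₀ * G * e

lemma abs_fluxSlope_le (H : IsBarenblattCDF m κ L Φ) {h a : ℝ} (hh : 0 < h) (ha : 0 < a * (a + h)) :
    |fluxSlope m κ L Φ (h, a)| ≤ (m + 1) * (1 + 1 / m) * κ * |2 * a + h| *
      (max (max (κ * (L ^ 2 - a ^ 2)) 0) (max (κ * (L ^ 2 - (a + h) ^ 2)) 0)) ^ (1 / m) := by
  have hm := H.m_pos
  have hκ := H.κ_pos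
  obtain ⟨ξ, hξ, hξ'⟩ := exists_hasDerivAt_eq_slope Φ (barenblatt m κ L) (show a < a + h by linarith)
    H.continuous.continuousOn fun x _ => H.hasDerivAt x
  rw [add_sub_cancel_left] at hξ'
  simp only [fluxSlope, ← hξ', H.barenblatt_rpow]
  set A := max (κ * (L ^ 2 - a ^ 2)) 0 with hA
  set B := max (κ * (L ^ 2 - (a + h) ^ 2)) 0 with hB
  have hA0 : 0 ≤ A := le_max_right _ _
  have hB0 : 0 ≤ B := le_max_right _ _
  have hq : 0 < 1 / m := by positivity
  have hξM : max (κ * (L ^ 2 - ξ ^ 2)) 0 ≤ max A B := by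
    rcases pos_and_pos_or_neg_and_neg_of_mul_pos ha with h1 | h1
    · refine le_trans (max_le_max_right _ ?_) (le_max_left A B)
      exact mul_le_mul_of_nonneg_left (by nlinarith [hξ.1]) hκ.le
    · refine le_trans (max_le_max_right _ ?_) (le_max_right A B)
      exact mul_le_mul_of_nonneg_left (by nlinarith [hξ.2]) hκ.le
  have hAB : |B - A| ≤ κ * h * |2 * a + h| := by
    refine (abs_max_sub_max_le_abs _ _ _).trans_eq ?_
    rw [show κ * (L ^ 2 - (a + h) ^ 2) - κ * (L ^ 2 - a ^ 2) = -(κ * h * (2 * a + h)) by ring,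
      abs_neg, abs_mul, abs_of_pos (mul_pos hκ hh)]
  have hpow : max A B * |B ^ (1 / m) - A ^ (1 / m)|
      ≤ (1 + 1 / m) * (max A B) ^ (1 / m) * |B - A| := by
    rcases le_total A B with h1 | h1
    · have := Real.rpow_le_rpow hA0 h1 hq.le
      rw [max_eq_right h1, abs_of_nonneg (by linarith), abs_of_nonneg (by linarith)]
      exact mul_rpow_sub_rpow_le hq hA0 h1
    · have := Real.rpow_le_rpow hB0 h1 hq.le
      rw [max_eq_left h1, abs_sub_comm, abs_sub_comm B, abs_of_nonneg (by linarith),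
        abs_of_nonneg (by linarith)]
      exact mul_rpow_sub_rpow_le hq hB0 h1
  change |(m + 1) * max (κ * (L ^ 2 - ξ ^ 2)) 0 * ((B ^ (1 / m) - A ^ (1 / m)) / h)| ≤ _
  have hM : 0 ≤ max A B := hA0.trans (le_max_left _ _)
  rw [abs_mul, abs_div, abs_of_pos hh,
    abs_of_nonneg (mul_nonneg (by linarith) (le_max_right (κ * (L ^ 2 - ξ ^ 2)) 0)),
    mul_div_assoc', div_le_iff₀ hh]
  calc (m + 1) * max (κ * (L ^ 2 - ξ ^ 2)) 0 * |B ^ (1 / m) - A ^ (1 / m)|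
      ≤ (m + 1) * max A B * |B ^ (1 / m) - A ^ (1 / m)| := by gcongr
    _ = (m + 1) * (max A B * |B ^ (1 / m) - A ^ (1 / m)|) := by ring
    _ ≤ (m + 1) * ((1 + 1 / m) * (max A B) ^ (1 / m) * (κ * h * |2 * a + h|)) := by
        refine mul_le_mul_of_nonneg_left (hpow.trans ?_) (by linarith)
        exact mul_le_mul_of_nonneg_left hAB (by positivity)
    _ = _ := by ring

lemma tendsto_fluxSlope_of_le (H : IsBarenblattCDF m κ L Φ) {a₀ : ℝ} (ha : L ^ 2 ≤ a₀ ^ 2) :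
    Tendsto (fluxSlope m κ L Φ) (𝓝[>] 0 ×ˢ 𝓝 a₀) (𝓝 0) := by
  have hm := H.m_pos
  have hκ := H.κ_pos
  have hL := H.L_pos
  have hq : 0 < 1 / m := by positivity
  have hle : 𝓝[>] (0 : ℝ) ×ˢ 𝓝 a₀ ≤ 𝓝 ((0 : ℝ), a₀) := by
    rw [nhds_prod_eq]
    exact Filter.prod_mono nhdsWithin_le_nhds le_rfl
  set G : ℝ × ℝ → ℝ := fun z => (m + 1) * (1 + 1 / m) * κ * |2 * z.2 + z.1| *
      (max (max (κ * (L ^ 2 - z.2 ^ 2)) 0) (max (κ * (L ^ 2 - (z.2 + z.1) ^ 2)) 0)) ^ (1 / m)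
    with hG
  have hGc : Continuous G := by
    refine Continuous.mul (by fun_prop) (Continuous.rpow_const (by fun_prop) fun _ => Or.inr hq.le)
  have hG0 : G (0, a₀) = 0 := by
    have : κ * (L ^ 2 - a₀ ^ 2) ≤ 0 := mul_nonpos_of_nonneg_of_nonpos hκ.le (by linarith)
    simp only [hG, add_zero, max_eq_right this, max_self]
    rw [Real.zero_rpow hq.ne', mul_zero]
  have ht : Tendsto G (𝓝[>] 0 ×ˢ 𝓝 a₀) (𝓝 0) := by
    have := (hGc.tendsto (0, a₀)).mono_left hle
    rwa [hG0] at this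
  refine squeeze_zero_norm' ?_ ht
  have hpos : ∀ᶠ z : ℝ × ℝ in 𝓝[>] 0 ×ˢ 𝓝 a₀, 0 < z.1 :=
    tendsto_fst.eventually eventually_mem_nhdsWithin
  have hsgn : ∀ᶠ z : ℝ × ℝ in 𝓝[>] 0 ×ˢ 𝓝 a₀, 0 < z.2 * (z.2 + z.1) := by
    refine Filter.Eventually.filter_mono hle ?_
    have hc : Continuous fun z : ℝ × ℝ => z.2 * (z.2 + z.1) := by fun_prop
    refine hc.continuousAt.eventually (lt_mem_nhds ?_)
    simp only [add_zero]
    nlinarith [sq_nonneg L, mul_pos hL hL]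
  filter_upwards [hpos, hsgn] with z hz hz'
  exact H.abs_fluxSlope_le hz hz'

lemma tendsto_fluxSlope (H : IsBarenblattCDF m κ L Φ) (a₀ : ℝ) :
    Tendsto (fluxSlope m κ L Φ) (𝓝[>] 0 ×ˢ 𝓝 a₀)
      (𝓝 (-2 / (m + 2) * a₀ * barenblatt m κ L a₀)) := by
  rcases lt_or_ge (a₀ ^ 2) (L ^ 2) with h | h
  · exact H.tendsto_fluxSlope_of_lt h
  · have hm := H.m_pos
    have hκ := H.κ_pos
    have : barenblatt m κ L a₀ = 0 := by
      rw [barenblatt, max_eq_right (mul_nonpos_of_nonneg_of_nonpos hκ.le (by linarith)),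
        Real.zero_rpow (by positivity)]
    rw [this, mul_zero]
    exact H.tendsto_fluxSlope_of_le h

/-- The discrete second difference in the scheme, at step `z.1` and position `z.2`. -/
noncomputable def fluxDiff (m : ℝ) (Φ : ℝ → ℝ) (z : ℝ × ℝ) : ℝ :=
  (((Φ (z.2 + z.1) - Φ z.2) / z.1) ^ (m + 1) - ((Φ z.2 - Φ (z.2 - z.1)) / z.1) ^ (m + 1)) / z.1

lemma tendsto_fluxDiff (H : IsBarenblattCDF m κ L Φ) (a₀ : ℝ) :
    Tendsto (fluxDiff m Φ) (𝓝[>] 0 ×ˢ 𝓝 a₀)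
      (𝓝 (-2 / (m + 2) * a₀ * barenblatt m κ L a₀)) := by
  have hm := H.m_pos
  have key : ∀ z : ℝ × ℝ, ∃ a', 0 < z.1 →
      a' ∈ Set.Ioo (z.2 - z.1) z.2 ∧ fluxSlope m κ L Φ (z.1, a') = fluxDiff m Φ z := by
    rintro ⟨h, a⟩
    by_cases hh : 0 < h
    · have hd : ∀ x, HasDerivAt (fun x => ((Φ (x + h) - Φ x) / h) ^ (m + 1))
          (fluxSlope m κ L Φ (h, x)) x := fun x => by
        have h1 : HasDerivAt (fun x => (Φ (x + h) - Φ x) / h)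
            ((barenblatt m κ L (x + h) - barenblatt m κ L x) / h) x :=
          (((H.hasDerivAt (x + h)).comp_add_const x h).sub (H.hasDerivAt x)).div_const h
        refine (h1.rpow_const (p := m + 1) (Or.inr (by linarith))).congr_deriv ?_
        simp only [fluxSlope, add_sub_cancel_right]
        ring
      obtain ⟨a', h1, h2⟩ := exists_hasDerivAt_eq_slope _ _ (show a - h < a by linarith)
        (fun x _ => (hd x).continuousAt.continuousWithinAt) fun x _ => hd x
      refine ⟨a', fun _ => ⟨h1, h2.trans ?_⟩⟩
      simp [fluxDiff]
    · exact ⟨0, fun h => absurd h hh⟩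
  choose a' ha' using key
  have hpos : ∀ᶠ z : ℝ × ℝ in 𝓝[>] 0 ×ˢ 𝓝 a₀, 0 < z.1 :=
    tendsto_fst.eventually eventually_mem_nhdsWithin
  have h1 : Tendsto (fun z : ℝ × ℝ => z.1) (𝓝[>] 0 ×ˢ 𝓝 a₀) (𝓝 0) :=
    tendsto_fst.mono_right nhdsWithin_le_nhds
  have h2 : Tendsto (fun z : ℝ × ℝ => z.2) (𝓝[>] 0 ×ˢ 𝓝 a₀) (𝓝 a₀) := tendsto_snd
  have h3 : Tendsto a' (𝓝[>] 0 ×ˢ 𝓝 a₀) (𝓝 a₀) := by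
    refine tendsto_of_tendsto_of_tendsto_of_le_of_le' (by simpa using h2.sub h1) h2 ?_ ?_
    · filter_upwards [hpos] with z hz using (ha' z hz).1.1.le
    · filter_upwards [hpos] with z hz using (ha' z hz).1.2.le
  refine ((H.tendsto_fluxSlope a₀).comp (tendsto_fst.prodMk h3)).congr' ?_
  filter_upwards [hpos] with z hz using (ha' z hz).2

/-- The rescaled one-step time increment of the self-similar solution. -/
noncomputable def timeDiff (m : ℝ) (Φ : ℝ → ℝ) (z : ℝ × ℝ) : ℝ :=
  (Φ (z.2 * (1 + z.1) ^ (-(1 / (m + 2)))) - Φ z.2) / z.1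

lemma tendsto_timeDiff (H : IsBarenblattCDF m κ L Φ) (a₀ : ℝ) :
    Tendsto (timeDiff m Φ) (𝓝[>] 0 ×ˢ 𝓝 a₀)
      (𝓝 (-(1 / (m + 2)) * a₀ * barenblatt m κ L a₀)) := by
  have hm := H.m_pos
  set β := 1 / (m + 2) with hβ
  set D : ℝ × ℝ → ℝ := fun z => barenblatt m κ L (z.2 * (1 + z.1) ^ (-β)) *
    (z.2 * (-β * (1 + z.1) ^ (-β - 1))) with hD
  have key : ∀ z : ℝ × ℝ, ∃ s, 0 < z.1 → s ∈ Set.Ioo 0 z.1 ∧ D (s, z.2) = timeDiff m Φ z := by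
    rintro ⟨τ, a⟩
    by_cases hτ : 0 < τ
    · have hd : ∀ s, 0 ≤ s → HasDerivAt (fun s => Φ (a * (1 + s) ^ (-β))) (D (s, a)) s :=
        fun s hs => by
        have h1 : HasDerivAt (fun s : ℝ => (1 + s) ^ (-β)) (1 * -β * (1 + s) ^ (-β - 1)) s :=
          ((hasDerivAt_id s).const_add 1).rpow_const (Or.inl (by simp; linarith))
        refine ((H.hasDerivAt (a * (1 + s) ^ (-β))).comp s (h1.const_mul a)).congr_deriv ?_
        simp only [hD, one_mul]
      obtain ⟨s, h1, h2⟩ := exists_hasDerivAt_eq_slope _ _ hτ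
        (fun x hx => (hd x hx.1).continuousAt.continuousWithinAt) fun x hx => hd x hx.1.le
      refine ⟨s, fun _ => ⟨h1, h2.trans ?_⟩⟩
      simp [timeDiff, hβ]
    · exact ⟨0, fun h => absurd h hτ⟩
  choose s hs using key
  have hpos : ∀ᶠ z : ℝ × ℝ in 𝓝[>] 0 ×ˢ 𝓝 a₀, 0 < z.1 :=
    tendsto_fst.eventually eventually_mem_nhdsWithin
  have h1 : Tendsto (fun z : ℝ × ℝ => z.1) (𝓝[>] 0 ×ˢ 𝓝 a₀) (𝓝 0) :=
    tendsto_fst.mono_right nhdsWithin_le_nhds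
  have h2 : Tendsto (fun z : ℝ × ℝ => z.2) (𝓝[>] 0 ×ˢ 𝓝 a₀) (𝓝 a₀) := tendsto_snd
  have h3 : Tendsto s (𝓝[>] 0 ×ˢ 𝓝 a₀) (𝓝 0) := by
    refine tendsto_of_tendsto_of_tendsto_of_le_of_le' tendsto_const_nhds h1 ?_ ?_
    · filter_upwards [hpos] with z hz using (hs z hz).1.1.le
    · filter_upwards [hpos] with z hz using (hs z hz).1.2.le
  have hDc : ContinuousAt D (0, a₀) := by
    have hF := H.continuous_barenblatt
    have hr : ∀ r : ℝ, ContinuousAt (fun z : ℝ × ℝ => (1 + z.1) ^ r) (0, a₀) := fun r =>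
      ContinuousAt.rpow_const (by fun_prop) (Or.inl (by simp))
    have h2 : ContinuousAt (fun z : ℝ × ℝ => z.2) ((0 : ℝ), a₀) := continuousAt_snd
    exact (hF.continuousAt.comp (h2.mul (hr _))).mul (h2.mul ((hr _).const_mul _))
  have h4 : Tendsto (fun z : ℝ × ℝ => (s z, z.2)) (𝓝[>] 0 ×ˢ 𝓝 a₀) (𝓝 (0, a₀)) := by
    rw [nhds_prod_eq]
    exact h3.prodMk h2
  have h5 := (hDc.tendsto.comp h4).congr' (f₂ := timeDiff m Φ)
    (by filter_upwards [hpos] with z hz using (hs z hz).2)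
  convert h5 using 2
  simp [hD]
  ring

/-- The rescaled truncation error of the self-similar solution, at step `z.1`, position `z.2`. -/
noncomputable def truncError (m : ℝ) (Φ : ℝ → ℝ) (z : ℝ × ℝ) : ℝ :=
  timeDiff m Φ (z.1 ^ (m + 2), z.2) - (1 / 2) * fluxDiff m Φ z

lemma tendsto_truncError (H : IsBarenblattCDF m κ L Φ) (a₀ : ℝ) :
    Tendsto (truncError m Φ) (𝓝[>] 0 ×ˢ 𝓝 a₀) (𝓝 0) := by
  have hm := H.m_pos
  have h1 : Tendsto (fun h : ℝ => h ^ (m + 2)) (𝓝[>] 0) (𝓝[>] 0) := by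
    refine tendsto_nhdsWithin_iff.2 ⟨?_, ?_⟩
    · have hc : ContinuousAt (fun h : ℝ => h ^ (m + 2)) 0 :=
        Real.continuousAt_rpow_const _ _ (Or.inr (by linarith))
      have := hc.tendsto
      rw [Real.zero_rpow (by linarith)] at this
      exact this.mono_left nhdsWithin_le_nhds
    · filter_upwards [self_mem_nhdsWithin] with h hh using Real.rpow_pos_of_pos hh _
  have h2 := (H.tendsto_timeDiff a₀).comp ((h1.comp tendsto_fst).prodMk tendsto_snd)
  have h3 := h2.sub ((H.tendsto_fluxDiff a₀).const_mul (1 / 2))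
  convert h3 using 2
  · rfl
  · ring

lemma truncError_eq_zero (H : IsBarenblattCDF m κ L Φ) {h a : ℝ} (hh : 0 < h) (hh1 : h < 1)
    (ha : 2 * L + 2 < |a|) : truncError m Φ (h, a) = 0 := by
  have hm := H.m_pos
  have hL := H.L_pos
  have hτ : 0 < h ^ (m + 2) := Real.rpow_pos_of_pos hh _
  have hτ1 : h ^ (m + 2) ≤ 1 := Real.rpow_le_one hh.le hh1.le (by linarith)
  set r := (1 + h ^ (m + 2)) ^ (-(1 / (m + 2))) with hr
  have hr0 : 1 / 2 ≤ r := by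
    have h1 : (1 + h ^ (m + 2)) ^ (1 / (m + 2)) ≤ 2 := by
      refine le_trans (Real.rpow_le_self_of_one_le (by linarith) ?_) (by linarith)
      rw [div_le_one (by linarith)]
      linarith
    rw [hr, Real.rpow_neg (by positivity), one_div]
    exact inv_anti₀ (by positivity) h1
  have hp : (0 : ℝ) ^ (m + 1) = 0 := Real.zero_rpow (by linarith)
  simp only [truncError, timeDiff, fluxDiff, ← hr]
  rcases lt_abs.1 ha with h1 | h1
  · rw [H.eq_one (a * r) (by nlinarith), H.eq_one a (by linarith), H.eq_one (a + h) (by linarith),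
      H.eq_one (a - h) (by linarith)]
    simp
  · rw [H.eq_zero (a * r) (by nlinarith), H.eq_zero a (by linarith), H.eq_zero (a + h) (by linarith),
      H.eq_zero (a - h) (by linarith)]
    simp

lemma exists_truncError_le (H : IsBarenblattCDF m κ L Φ) {ε : ℝ} (hε : 0 < ε) :
    ∃ h₀ > 0, ∀ h, 0 < h → h < h₀ → ∀ a, |truncError m Φ (h, a)| ≤ ε := by
  have hu : TendstoUniformlyOn (fun h a => truncError m Φ (h, a)) (fun _ => 0) (𝓝[>] 0)
      (Set.Icc (-(2 * L + 2)) (2 * L + 2)) := by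
    rw [← tendstoLocallyUniformlyOn_iff_tendstoUniformlyOn_of_compact isCompact_Icc,
      tendstoLocallyUniformlyOn_iff_forall_tendsto]
    intro a _
    have h1 := (H.tendsto_truncError a).mono_left
      (Filter.prod_mono le_rfl (nhdsWithin_le_nhds (s := Set.Icc (-(2 * L + 2)) (2 * L + 2))))
    exact Uniform.tendsto_nhds_right.1 h1
  have h1 := Metric.tendstoUniformlyOn_iff.1 hu ε hε
  obtain ⟨h₀, hh₀, hh⟩ := mem_nhdsGT_iff_exists_Ioo_subset.1 h1
  refine ⟨min h₀ 1, lt_min hh₀ one_pos, fun h h0 hlt a => ?_⟩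
  rcases le_or_gt |a| (2 * L + 2) with ha | ha
  · have := hh ⟨h0, hlt.trans_le (min_le_left _ _)⟩ a (abs_le.1 ha)
    rw [dist_zero_left] at this
    exact this.le
  · rw [H.truncError_eq_zero h0 (hlt.trans_le (min_le_right _ _)) ha, abs_zero]
    exact hε.le

lemma sub_cdfStep_eq (H : IsBarenblattCDF m κ L Φ) {t : ℝ} (ht : 0 < t) (x₀ : ℝ) (k : ℤ) :
    Φ ((k + x₀) * (t + 1) ^ (-(1 / (m + 2)))) -
        cdfStep m (fun j : ℤ => Φ ((j + x₀) * t ^ (-(1 / (m + 2))))) k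
      = t⁻¹ * truncError m Φ (t ^ (-(1 / (m + 2))), (k + x₀) * t ^ (-(1 / (m + 2)))) := by
  have hm := H.m_pos
  set β := 1 / (m + 2) with hβ
  have hh : 0 < t ^ (-β) := Real.rpow_pos_of_pos ht _
  have e1 : (t ^ (-β)) ^ (m + 2) = t⁻¹ := by
    rw [← Real.rpow_mul ht.le, ← Real.rpow_neg_one]
    congr 1
    rw [hβ]
    field_simp
  have e2 : (t + 1) ^ (-β) = t ^ (-β) * (1 + t⁻¹) ^ (-β) := by
    rw [← Real.mul_rpow ht.le (by positivity)]
    congr 1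
    field_simp
  have hmono : ∀ b c : ℝ, b ≤ c → 0 ≤ (Φ c - Φ b) / t ^ (-β) := fun b c h =>
    div_nonneg (sub_nonneg.2 (H.monotone h)) hh.le
  rw [e2]
  simp only [truncError, timeDiff, fluxDiff, e1, ← hβ, cdfStep]
  push_cast
  have e3 : ((k : ℝ) + 1 + x₀) * t ^ (-β) = (k + x₀) * t ^ (-β) + t ^ (-β) := by ring
  have e4 : ((k : ℝ) - 1 + x₀) * t ^ (-β) = (k + x₀) * t ^ (-β) - t ^ (-β) := by ring
  rw [e3, e4, mul_assoc]
  set h := t ^ (-β)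
  have e5 : t⁻¹ = h ^ (m + 1) * h := by
    rw [← e1, ← Real.rpow_add_one hh.ne']
    congr 1
    ring
  have e6 : ∀ b c : ℝ, b ≤ c → (Φ c - Φ b) ^ (m + 1) = h ^ (m + 1) * ((Φ c - Φ b) / h) ^ (m + 1) :=
    fun b c hbc => by
    rw [← Real.mul_rpow hh.le (hmono b c hbc)]
    congr 1
    field_simp
  rw [e6 ((k + x₀) * h) _ (by linarith), e6 _ ((k + x₀) * h) (by linarith), ← mul_assoc]
  have ht' : t⁻¹ ≠ 0 := (inv_pos.2 ht).ne'
  generalize Φ ((k + x₀) * h * (1 + t⁻¹) ^ (-β)) = P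
  generalize ((Φ ((k + x₀) * h + h) - Φ ((k + x₀) * h)) / h) ^ (m + 1) = Q
  generalize ((Φ ((k + x₀) * h) - Φ ((k + x₀) * h - h)) / h) ^ (m + 1) = R
  have e7 : t⁻¹ * ((P - Φ ((k + x₀) * h)) / t⁻¹) = P - Φ ((k + x₀) * h) :=
    mul_div_cancel₀ _ ht'
  have e8 : h * ((Q - R) / h) = Q - R := mul_div_cancel₀ _ hh.ne'
  rw [mul_sub, e7, e5]
  linear_combination (1 / 2) * h ^ (m + 1) * e8

lemma boundedIncrements (H : IsBarenblattCDF m κ L Φ) {h x₀ : ℝ} (hh : 0 < h)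
    (hC : barenblatt m κ L 0 * h ≤ (m + 1) ^ (-(1 / m) : ℝ)) :
    BoundedIncrements m fun j : ℤ => Φ ((j + x₀) * h) := fun k => by
  have e : ((k : ℝ) + x₀) * h - (((k - 1 : ℤ) : ℝ) + x₀) * h = h := by push_cast; ring
  refine ⟨sub_nonneg.2 (H.monotone (by linarith)), ?_⟩
  have h1 := (le_abs_self _).trans (H.abs_sub_le ((k + x₀) * h) ((((k - 1 : ℤ) : ℝ) + x₀) * h))
  rw [e, abs_of_pos hh] at h1
  exact h1.trans hC

/-- Solutions of the scheme are squeezed between two shifted and delayed Barenblatt solutions. -/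
lemma squeeze (H : IsBarenblattCDF m κ L Φ) {U : ℕ → ℤ → ℝ}
    (hU : ∀ n, BoundedIncrements m (U n)) (hstep : ∀ n k, U (n + 1) k = cdfStep m (U n) k)
    (hU0 : ∀ k, 0 ≤ U 0 k ∧ U 0 k ≤ 1) {ε ε' R h₀ T : ℝ} (hε : 0 ≤ ε)
    (hleft : ∀ k : ℤ, (k : ℝ) < -R → U 0 k ≤ ε) (hright : ∀ k : ℤ, R ≤ k → 1 - ε ≤ U 0 k)
    (htrunc : ∀ h, 0 < h → h < h₀ → ∀ a, |truncError m Φ (h, a)| ≤ ε') (hT : 0 < T)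
    (hTh : T ^ (-(1 / (m + 2))) < h₀)
    (hTC : barenblatt m κ L 0 * T ^ (-(1 / (m + 2))) ≤ (m + 1) ^ (-(1 / m) : ℝ)) (n : ℕ) (k : ℤ) :
    U n k ≤ Φ ((k + (R + L * T ^ (1 / (m + 2)))) * (T + n) ^ (-(1 / (m + 2))))
        + (ε + n * (ε' / T)) ∧
      Φ ((k + -(R + L * T ^ (1 / (m + 2)))) * (T + n) ^ (-(1 / (m + 2))))
        ≤ U n k + (ε + n * (ε' / T)) := by
  have hm := H.m_pos
  set β := 1 / (m + 2) with hβ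
  have hβ0 : 0 < β := by positivity
  have hh : ∀ n : ℕ, 0 < (T + n) ^ (-β) := fun n => by positivity
  have hle : ∀ n : ℕ, (T + n) ^ (-β) ≤ T ^ (-β) := fun n =>
    Real.rpow_le_rpow_of_nonpos hT (by linarith [n.cast_nonneg (α := ℝ)]) (by linarith)
  obtain ⟨V, hVdef⟩ : ∃ V : ℝ → ℕ → ℤ → ℝ, ∀ x₀ n,
      V x₀ n = fun j : ℤ => Φ ((j + x₀) * (T + n) ^ (-β)) := ⟨_, fun _ _ => rfl⟩
  have hV0 : ∀ x₀ k, V x₀ 0 k = Φ ((k + x₀) * T ^ (-β)) := fun x₀ k => by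
    rw [hVdef, Nat.cast_zero, add_zero]
  have hV : ∀ x₀ n, BoundedIncrements m (V x₀ n) := fun x₀ n => by
    rw [hVdef]
    exact H.boundedIncrements (hh n)
      ((mul_le_mul_of_nonneg_left (hle n) (barenblatt_nonneg 0)).trans hTC)
  have herr : ∀ x₀ n k, |V x₀ (n + 1) k - cdfStep m (V x₀ n) k| ≤ ε' / T := fun x₀ n k => by
    have hn : 0 < T + n := by positivity
    rw [hVdef, hVdef, Nat.cast_succ, ← add_assoc, H.sub_cdfStep_eq hn x₀ k, abs_mul,
      abs_of_pos (inv_pos.2 hn), div_eq_inv_mul ε']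
    exact mul_le_mul (inv_anti₀ hT (by linarith [n.cast_nonneg (α := ℝ)]))
      (htrunc _ (hh n) ((hle n).trans_lt hTh) _) (abs_nonneg _) (by positivity)
  have hTT : (R + L * T ^ β) * T ^ (-β) = R * T ^ (-β) + L := by
    rw [add_mul, mul_assoc, ← Real.rpow_add hT, add_neg_cancel, Real.rpow_zero, mul_one]
  have hT0 : 0 < T ^ (-β) := Real.rpow_pos_of_pos hT _
  have hVn : ∀ x₀, Φ ((k + x₀) * (T + n) ^ (-β)) = V x₀ n k := fun x₀ => by rw [hVdef]
  generalize R + L * T ^ β = S at hTT ⊢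
  rw [hVn, hVn]
  constructor
  · refine le_add_of_approx_cdfStep hm hU (hV S) (fun k => ?_) (fun n k => ?_) n k
    · rw [hV0]
      rcases lt_or_ge (k : ℝ) (-R) with h | h
      · exact (hleft k h).trans (le_add_of_nonneg_left (H.nonneg _))
      · have := mul_le_mul_of_nonneg_right h hT0.le
        rw [H.eq_one _ (by linarith)]
        linarith [hU0 k]
    · rw [hstep, sub_self]
      linarith [(abs_le.1 (herr S n k)).1]
  · refine le_add_of_approx_cdfStep hm (hV (-S)) hU (fun k => ?_) (fun n k => ?_) n k
    · rw [hV0]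
      rcases lt_or_ge (k : ℝ) R with h | h
      · have := mul_le_mul_of_nonneg_right h.le hT0.le
        rw [H.eq_zero _ (by linarith)]
        linarith [hU0 k]
      · linarith [hright k h, H.le_one ((k + -S) * T ^ (-β))]
    · rw [hstep (n := n), sub_self]
      linarith [(abs_le.1 (herr (-S) n k)).2]

end IsBarenblattCDF

/-- Rescaling a lattice point near `x * N`, shifted by `y`, with a small delay `r`, moves it
little. -/
lemma abs_rescale_sub_le {x X N r E y Y k : ℝ} (hN : 0 < N) (hx : |x| ≤ X) (hr : 0 ≤ r)
    (hE : 1 - r ≤ E) (hE1 : E ≤ 1) (hE0 : 0 ≤ E) (hk : |k - x * N| ≤ 1) (hy : |y| ≤ Y) :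
    |(k + y) * (E * N⁻¹) - x| ≤ X * r + (1 + Y) * N⁻¹ := by
  have e : (k + y) * (E * N⁻¹) - x = x * (E - 1) + (k - x * N + y) * (E * N⁻¹) := by
    field_simp
    ring
  rw [e]
  refine (abs_add_le _ _).trans (add_le_add ?_ ?_)
  · rw [abs_mul]
    exact mul_le_mul hx (abs_le.2 ⟨by linarith, by linarith⟩) (abs_nonneg _)
      ((abs_nonneg _).trans hx)
  · have hN' : 0 < N⁻¹ := inv_pos.2 hN
    rw [abs_mul, abs_of_nonneg (mul_nonneg hE0 hN'.le)]
    exact mul_le_mul ((abs_add_le _ _).trans (add_le_add hk hy))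
      (by nlinarith) (by positivity) (by linarith [abs_nonneg y])

open Topology in
lemma IsBarenblattCDF.tendsto_cumSum {m κ L : ℝ} {Φ : ℝ → ℝ} (H : IsBarenblattCDF m κ L Φ)
    {U : ℕ → ℤ → ℝ} (hU : ∀ n, BoundedIncrements m (U n))
    (hstep : ∀ n k, U (n + 1) k = cdfStep m (U n) k) (hU0 : ∀ k, 0 ≤ U 0 k ∧ U 0 k ≤ 1)
    (htails : ∀ ε > 0, ∃ R : ℝ, 0 ≤ R ∧ (∀ k : ℤ, (k : ℝ) < -R → U 0 k ≤ ε) ∧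
      ∀ k : ℤ, R ≤ k → 1 - ε ≤ U 0 k) {X η : ℝ} (hη : 0 < η) :
    ∀ᶠ n : ℕ in atTop, ∀ x, |x| ≤ X → |Φ x - U n ⌊x * (n : ℝ) ^ (1 / (m + 2))⌋| < η := by
  have hm := H.m_pos
  have hL := H.L_pos
  set β := 1 / (m + 2) with hβ
  have hβ0 : 0 < β := by positivity
  have hβ1 : β ≤ 1 := by rw [hβ, div_le_one (by linarith)]; linarith
  set C := barenblatt m κ L 0 with hC
  have hC0 : 0 ≤ C := IsBarenblattCDF.barenblatt_nonneg 0
  obtain ⟨r, hr, hrC⟩ : ∃ r : ℝ, 0 < r ∧ C * (X * r + L * r ^ β) < η / 4 := by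
    have hc : ContinuousAt (fun r : ℝ => C * (X * r + L * r ^ β)) 0 :=
      ((by fun_prop : ContinuousAt (fun r : ℝ => X * r) 0).add
        ((Real.continuousAt_rpow_const _ _ (Or.inr hβ0.le)).const_mul L)).const_mul C
    have h0 : C * (X * 0 + L * (0 : ℝ) ^ β) < η / 4 := by
      rw [Real.zero_rpow hβ0.ne']
      linarith
    have := (hc.eventually (gt_mem_nhds h0)).filter_mono (nhdsWithin_le_nhds (s := Set.Ioi 0))
    obtain ⟨r, h1, h2⟩ := (this.and self_mem_nhdsWithin).exists
    exact ⟨r, h2, h1⟩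
  obtain ⟨R, hR, hleft, hright⟩ := htails (η / 8) (by linarith)
  obtain ⟨h₀, hh₀, htrunc⟩ := H.exists_truncError_le (show 0 < r * (η / 8) by positivity)
  have hlim : Tendsto (fun n : ℕ => (n : ℝ) ^ (-β)) atTop (𝓝 0) :=
    (tendsto_rpow_neg_atTop hβ0).comp tendsto_natCast_atTop_atTop
  have hlim' : Tendsto (fun n : ℕ => (r * n) ^ (-β)) atTop (𝓝 0) :=
    (tendsto_rpow_neg_atTop hβ0).comp (tendsto_natCast_atTop_atTop.const_mul_atTop hr)
  have ev1 := hlim'.eventually (gt_mem_nhds hh₀)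
  have ev2 := (hlim'.const_mul C).eventually (gt_mem_nhds
    (show C * 0 < (m + 1) ^ (-(1 / m) : ℝ) by rw [mul_zero]; exact threshold_pos hm))
  have ev3 := (hlim.const_mul (C * (1 + R))).eventually (gt_mem_nhds
    (show C * (1 + R) * 0 < η / 4 by linarith))
  filter_upwards [ev1, ev2, ev3, eventually_gt_atTop 0] with n hn1 hn2 hn3 hn x hx
  have hn' : (0 : ℝ) < n := by exact_mod_cast hn
  have hsq := H.squeeze hU hstep hU0 (by linarith) hleft hright htrunc
    (mul_pos hr hn') hn1 hn2.le n ⌊x * (n : ℝ) ^ β⌋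
  rw [← hβ] at hsq
  have herr : η / 8 + n * (r * (η / 8) / (r * n)) = η / 4 := by
    field_simp
    ring
  have hN : 0 < (n : ℝ) ^ β := Real.rpow_pos_of_pos hn' _
  have hT : (r * n + n) ^ (-β) = (1 + r) ^ (-β) * ((n : ℝ) ^ β)⁻¹ := by
    rw [show r * n + n = (1 + r) * n by ring, Real.mul_rpow (by positivity) hn'.le,
      Real.rpow_neg hn'.le]
  rw [herr, hT, Real.mul_rpow hr.le hn'.le] at hsq
  rw [Real.rpow_neg hn'.le] at hn3
  have hE1 : (1 + r) ^ (-β) ≤ 1 :=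
    Real.rpow_le_one_of_one_le_of_nonpos (by linarith) (by linarith)
  have hE : 1 - r ≤ (1 + r) ^ (-β) := by
    have h1 : (1 + r) ^ β ≤ 1 + r := Real.rpow_le_self_of_one_le (by linarith) hβ1
    have h2 : 0 < (1 + r) ^ β := by positivity
    rw [Real.rpow_neg (by positivity)]
    refine le_trans ?_ (inv_anti₀ h2 h1)
    rw [← one_div, le_div_iff₀ (by linarith)]
    nlinarith
  have hk : |(⌊x * (n : ℝ) ^ β⌋ : ℝ) - x * (n : ℝ) ^ β| ≤ 1 := by
    rw [abs_le]
    constructor <;>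
      linarith [Int.floor_le (x * (n : ℝ) ^ β), Int.lt_floor_add_one (x * (n : ℝ) ^ β)]
  have hclose : ∀ y, |y| ≤ R + L * (r ^ β * (n : ℝ) ^ β) →
      |Φ ((⌊x * (n : ℝ) ^ β⌋ + y) * ((1 + r) ^ (-β) * ((n : ℝ) ^ β)⁻¹)) - Φ x| < η / 2 :=
    fun y hy => by
    refine (H.abs_sub_le _ _).trans_lt ?_
    have h1 := abs_rescale_sub_le hN hx hr.le hE hE1 (by positivity) hk hy
    have h2 := mul_le_mul_of_nonneg_left h1 hC0
    refine h2.trans_lt ?_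
    have e : C * (X * r + (1 + (R + L * (r ^ β * (n : ℝ) ^ β))) * ((n : ℝ) ^ β)⁻¹)
        = C * (X * r + L * r ^ β) + C * (1 + R) * ((n : ℝ) ^ β)⁻¹ := by
      field_simp
      ring
    rw [e]
    linarith
  have hy0 : 0 ≤ R + L * (r ^ β * (n : ℝ) ^ β) := by positivity
  have h1 := abs_lt.1 (hclose _ (abs_of_nonneg hy0).le)
  have h2 := abs_lt.1 (hclose _ ((abs_neg _).trans (abs_of_nonneg hy0)).le)
  rw [abs_lt]
  constructor <;> linarith [hsq.1, hsq.2]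

theorem statement1
    (m : ℝ) (hm : 0 < m)
    (p : ℕ → ℤ → ℝ)
    (h0nonneg : ∀ k : ℤ, 0 ≤ p 0 k)
    (h0sum : HasSum (p 0) 1)
    (h0bdd : ∀ k : ℤ, p 0 k ≤ (m + 1) ^ (-(1 / m) : ℝ))
    (hrec : ∀ (n : ℕ) (k : ℤ),
      p (n + 1) k =
        p n k * (1 - p n k ^ m) + (1 / 2) * p n (k + 1) ^ (m + 1)
          + (1 / 2) * p n (k - 1) ^ (m + 1)) :
    ∀ K : Set ℝ, IsCompact K →
      TendstoUniformlyOn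
        (fun (n : ℕ) (x : ℝ) =>
          ∑' k : ℤ, if (k : ℝ) ≤ x * (n : ℝ) ^ (1 / (m + 2)) then p n k else 0)
        (fun x => limitCDF m x) atTop K := by
  intro K hK
  have hp := mem_Icc_threshold hm h0nonneg h0bdd hrec
  have hsum := summable_mass hm h0sum.summable hp hrec
  obtain ⟨X, hX⟩ := hK.isBounded.exists_norm_le
  refine Metric.tendstoUniformlyOn_iff.2 fun η hη => ?_
  have key := (isBarenblattCDF_limitCDF hm).tendsto_cumSum (U := fun n => cumSum (p n))
    (fun n k => by rw [cumSum_sub_pred (hsum n)]; exact hp n k)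
    (fun n k => cumSum_succ hm hsum hp hrec n k) (cumSum_mem_Icc h0nonneg h0sum)
    (fun ε hε => exists_cumSum_tails h0nonneg h0sum hε) (X := X) hη
  filter_upwards [key] with n hn x hx
  have h := hn x (hX x hx)
  simpa only [cumSum, Int.le_floor, Real.dist_eq] using h
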